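/- arXiv:1603.08014 — 3 statements merged into one kernel-verified Lean document; each statement's English description precedes it below -/
import Mathlib

section
/- (Proposition 3, necessary condition for optimal deployment) Let Q ⊆ ℝ² be a compact convex set, λ a nonnegative integrable density on Q, and η_1,…,η_n > 0 cost parameters. Define the distortion of a deployment P = (p_1,…,p_n) ∈ (ℝ²)ⁿ as D(P) = ∫_Q (min_{1 ≤ i ≤ n} η_i‖q − p_i‖²) λ(q) dq. Suppose P* = (p*_1,…,p*_n) minimizes D over (ℝ²)ⁿ. Then for every index j whose weighted Voronoi region V_j(P*) = {q ∈ Q : η_j‖q − p*_j‖² ≤ η_t‖q − p*_t‖² for all t} has positive mass M_j = ∫_{V_j(P*)} λ(q) dq > 0, the sensor location coincides with the centroid of its region: p*_j = (1/M_j) ∫_{V_j(P*)} q λ(q) dq. -/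
open MeasureTheory

section Distortion

variable {ι E : Type*} [Finite ι] [NormedAddCommGroup E]

/-- The smallest weighted squared distance to finitely many sites is a continuous function. -/
theorem continuous_iInf_weighted_sq_dist [Nonempty ι] (η : ι → ℝ) (P : ι → E) :
    Continuous fun q ↦ ⨅ i, η i * ‖q - P i‖ ^ 2 := by
  cases nonempty_fintype ι
  simp_rw [← Finset.inf'_univ_eq_ciInf]
  exact Continuous.finset_inf'_apply _ fun i _ ↦ by fun_prop

/-- Moving the single site `P j` to `c` changes the pointwise minimum by at most
`η j * (‖q - c‖ ^ 2 - ‖q - P j‖ ^ 2)` on the Voronoi region of `j`. -/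
theorem iInf_update_le_of_mem_voronoi [DecidableEq ι] (η : ι → ℝ) (P : ι → E) (j : ι) (c q : E)
    (hq : ∀ t, η j * ‖q - P j‖ ^ 2 ≤ η t * ‖q - P t‖ ^ 2) :
    ⨅ i, η i * ‖q - Function.update P j c i‖ ^ 2 ≤
      (⨅ i, η i * ‖q - P i‖ ^ 2) + η j * (‖q - c‖ ^ 2 - ‖q - P j‖ ^ 2) := by
  have : Nonempty ι := ⟨j⟩
  have h₁ := ciInf_le (Set.finite_range fun i ↦
    η i * ‖q - Function.update P j c i‖ ^ 2).bddBelow j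
  have h₂ := le_ciInf hq
  simp only [Function.update_self] at h₁
  linarith

/-- Moving the single site `P j` does not increase the pointwise minimum off the Voronoi region
of `j`. -/
theorem iInf_update_le_of_notMem_voronoi [DecidableEq ι] (η : ι → ℝ) (P : ι → E) (j : ι)
    (c q : E) (hq : ¬ ∀ t, η j * ‖q - P j‖ ^ 2 ≤ η t * ‖q - P t‖ ^ 2) :
    ⨅ i, η i * ‖q - Function.update P j c i‖ ^ 2 ≤ ⨅ i, η i * ‖q - P i‖ ^ 2 := by
  have : Nonempty ι := ⟨j⟩
  obtain ⟨t, ht⟩ := exists_eq_ciInf_of_finite (f := fun i ↦ η i * ‖q - P i‖ ^ 2)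
  have htj : t ≠ j := by
    rintro rfl
    exact hq fun s ↦ ht.trans_le (ciInf_le (Set.finite_range _).bddBelow s)
  have h₁ := ciInf_le (Set.finite_range fun i ↦
    η i * ‖q - Function.update P j c i‖ ^ 2).bddBelow t
  simp only [Function.update_of_ne htj] at h₁
  exact h₁.trans_eq ht

end Distortion

/-- The parallel axis identity: replacing `p` by the centroid `c` decreases the second moment
by the mass times `‖c - p‖ ^ 2`. -/
theorem setIntegral_sq_dist_sub_sq_dist {E : Type*} [NormedAddCommGroup E]
    [InnerProductSpace ℝ E] [CompleteSpace E] [MeasurableSpace E] {μ : Measure E} {V : Set E}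
    {w : E → ℝ} (hw : IntegrableOn w V μ) (hwq : IntegrableOn (fun q ↦ w q • q) V μ)
    (p c : E) (hc : ∫ q in V, w q • q ∂μ = (∫ q in V, w q ∂μ) • c) :
    ∫ q in V, (‖q - c‖ ^ 2 - ‖q - p‖ ^ 2) * w q ∂μ = -((∫ q in V, w q ∂μ) * ‖c - p‖ ^ 2) := by
  have h (q : E) : (‖q - c‖ ^ 2 - ‖q - p‖ ^ 2) * w q =
      (‖c‖ ^ 2 - ‖p‖ ^ 2) * w q - 2 * inner ℝ (c - p) (w q • q) := by
    rw [norm_sub_sq_real, norm_sub_sq_real, inner_smul_right, inner_sub_left,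
      real_inner_comm q c, real_inner_comm q p]
    ring
  simp_rw [h]
  rw [integral_sub (hw.const_mul _) ((hwq.const_inner _).const_mul _), integral_const_mul,
    integral_const_mul, integral_inner hwq, hc, inner_smul_right, norm_sub_sq_real,
    inner_sub_left, real_inner_self_eq_norm_sq, real_inner_comm c p]
  ring

/-- Proposition 3, necessary condition for optimal deployment: if the
deployment `P` minimizes the distortion
`D(P) = ∫_Q (minᵢ ηᵢ‖q − Pᵢ‖²) lam(q) dq` over all deployments, then every sensor `j`
whose weighted Voronoi region has positive mass is located at the centroid of its
region. -/
theorem optimal_deployment_sensor_at_centroid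
    {n : ℕ} (hn : 0 < n)
    (Q : Set (EuclideanSpace ℝ (Fin 2))) (hQc : IsCompact Q) (hQconv : Convex ℝ Q)
    (lam : EuclideanSpace ℝ (Fin 2) → ℝ) (hnn : ∀ q, 0 ≤ lam q)
    (hint : IntegrableOn lam Q)
    (η : Fin n → ℝ) (hη : ∀ i, 0 < η i)
    (P : Fin n → EuclideanSpace ℝ (Fin 2))
    (hopt : ∀ P' : Fin n → EuclideanSpace ℝ (Fin 2),
      (∫ q in Q, (⨅ i, η i * ‖q - P i‖ ^ 2) * lam q)
        ≤ ∫ q in Q, (⨅ i, η i * ‖q - P' i‖ ^ 2) * lam q)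
    (j : Fin n)
    (hM : 0 < ∫ q in {q ∈ Q | ∀ t, η j * ‖q - P j‖ ^ 2 ≤ η t * ‖q - P t‖ ^ 2}, lam q) :
    P j = (∫ q in {q ∈ Q | ∀ t, η j * ‖q - P j‖ ^ 2 ≤ η t * ‖q - P t‖ ^ 2}, lam q)⁻¹ •
        ∫ q in {q ∈ Q | ∀ t, η j * ‖q - P j‖ ^ 2 ≤ η t * ‖q - P t‖ ^ 2}, lam q • q := by
  have : Nonempty (Fin n) := ⟨j⟩
  set V := {q ∈ Q | ∀ t, η j * ‖q - P j‖ ^ 2 ≤ η t * ‖q - P t‖ ^ 2}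
  set M := ∫ q in V, lam q
  set c := M⁻¹ • ∫ q in V, lam q • q with hcdef
  have hVQ : V ⊆ Q := Set.sep_subset _ _
  have hVm : MeasurableSet V := by
    have h : IsClosed {q | ∀ t, η j * ‖q - P j‖ ^ 2 ≤ η t * ‖q - P t‖ ^ 2} := by
      simp only [Set.ofPred_forall]
      exact isClosed_iInter fun t ↦ isClosed_le (by fun_prop) (by fun_prop)
    exact hQc.measurableSet.inter h.measurableSet
  have hmul {g : EuclideanSpace ℝ (Fin 2) → ℝ} (hg : Continuous g) :
      IntegrableOn (fun q ↦ g q * lam q) Q := hint.continuousOn_mul hg.continuousOn hQc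
  have hgap : IntegrableOn (fun q ↦ (‖q - c‖ ^ 2 - ‖q - P j‖ ^ 2) * lam q) Q :=
    hmul (by fun_prop)
  have hle : ∫ q in Q, (⨅ i, η i * ‖q - Function.update P j c i‖ ^ 2) * lam q ≤
      ∫ q in Q, ((⨅ i, η i * ‖q - P i‖ ^ 2) * lam q +
        V.indicator (fun q ↦ η j * ((‖q - c‖ ^ 2 - ‖q - P j‖ ^ 2) * lam q)) q) := by
    refine setIntegral_mono_on (hmul (continuous_iInf_weighted_sq_dist _ _))
      ((hmul (continuous_iInf_weighted_sq_dist _ _)).add ((hgap.const_mul _).indicator hVm))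
      hQc.measurableSet fun q hq ↦ ?_
    by_cases hqV : q ∈ V
    · rw [Set.indicator_of_mem hqV, ← mul_assoc, ← add_mul]
      exact mul_le_mul_of_nonneg_right (iInf_update_le_of_mem_voronoi η P j c q hqV.2) (hnn q)
    · rw [Set.indicator_of_notMem hqV, add_zero]
      exact mul_le_mul_of_nonneg_right
        (iInf_update_le_of_notMem_voronoi η P j c q fun h ↦ hqV ⟨hq, h⟩) (hnn q)
  rw [integral_add (hmul (continuous_iInf_weighted_sq_dist _ _))
    ((hgap.const_mul _).indicator hVm), setIntegral_indicator hVm,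
    Set.inter_eq_self_of_subset_right hVQ, integral_const_mul,
    setIntegral_sq_dist_sub_sq_dist (hint.mono_set hVQ)
      ((hint.smul_continuousOn continuousOn_id hQc).mono_set hVQ) (P j) c
      (by rw [hcdef, smul_inv_smul₀ hM.ne'])] at hle
  have hgain : η j * (M * ‖c - P j‖ ^ 2) ≤ 0 := by
    linarith [hopt (Function.update P j c)]
  have hsq : ‖c - P j‖ ^ 2 ≤ 0 := by
    rw [← mul_assoc] at hgain
    exact nonpos_of_mul_nonpos_right hgain (mul_pos (hη j) hM)
  have hnorm : ‖c - P j‖ = 0 := pow_eq_zero_iff two_ne_zero |>.1 (hsq.antisymm (sq_nonneg _))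
  exact (sub_eq_zero.1 (norm_eq_zero.1 hnorm)).symm
end

section
/- Fix n sensors in ℝ² at locations p_1,…,p_n with positive cost parameters η_1,…,η_n and a convex set Q ⊆ ℝ². For each k, the relaxed region V̄_k = {q ∈ Q : η_k‖q − p_k‖² ≤ η_i‖q − p_i‖² for all i with η_i ≤ η_k}, obtained by ignoring all sensors with strictly larger cost parameters, is a convex set. -/
theorem norm_convexCombination_sub_sq {E : Type*} [NormedAddCommGroup E] [InnerProductSpace ℝ E]
    (x y c : E) {a b : ℝ} (hab : a + b = 1) :
    ‖a • x + b • y - c‖ ^ 2 = a * ‖x - c‖ ^ 2 + b * ‖y - c‖ ^ 2 - a * b * ‖x - y‖ ^ 2 := by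
  have hcomb : a • x + b • y - c = a • (x - c) + b • (y - c) := by
    rw [smul_sub, smul_sub, sub_add_sub_comm, ← add_smul, hab, one_smul]
  have hsub : x - y = (x - c) - (y - c) := by abel
  rw [hcomb, hsub, norm_add_sq_real, norm_sub_sq_real (x - c), norm_smul, norm_smul,
    real_inner_smul_left, real_inner_smul_right, mul_pow, mul_pow, Real.norm_eq_abs,
    Real.norm_eq_abs, sq_abs, sq_abs]
  obtain rfl : b = 1 - a := by linarith
  ring

/-- The set of points whose squared distance to `c`, weighted by `r`, is at most their squared
distance to `d`, weighted by a smaller `s`, is convex. -/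
theorem convex_setOf_mul_norm_sub_sq_le {E : Type*} [NormedAddCommGroup E]
    [InnerProductSpace ℝ E] (c d : E) {r s : ℝ} (hsr : s ≤ r) :
    Convex ℝ {q : E | r * ‖q - c‖ ^ 2 ≤ s * ‖q - d‖ ^ 2} := by
  intro x hx y hy a b ha hb hab
  simp only [Set.mem_ofPred_eq] at hx hy ⊢
  rw [norm_convexCombination_sub_sq x y c hab, norm_convexCombination_sub_sq x y d hab]
  have hxy : s * (a * b * ‖x - y‖ ^ 2) ≤ r * (a * b * ‖x - y‖ ^ 2) := by gcongr
  linarith [mul_le_mul_of_nonneg_left hx ha, mul_le_mul_of_nonneg_left hy hb]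

/-- the relaxed region
`V̄ₖ = {q ∈ Q : ηₖ‖q − pₖ‖² ≤ ηᵢ‖q − pᵢ‖² for all i with ηᵢ ≤ ηₖ}`, obtained by ignoring
all sensors with strictly larger cost parameters, is convex whenever `Q` is convex. -/
theorem relaxed_region_convex
    {n : ℕ} (p : Fin n → EuclideanSpace ℝ (Fin 2))
    (η : Fin n → ℝ) (hη : ∀ i, 0 < η i)
    (Q : Set (EuclideanSpace ℝ (Fin 2))) (hQ : Convex ℝ Q)
    (k : Fin n) :
    Convex ℝ {q ∈ Q | ∀ i, η i ≤ η k → η k * ‖q - p k‖ ^ 2 ≤ η i * ‖q - p i‖ ^ 2} := by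
  intro x hx y hy a b ha hb hab
  exact ⟨hQ hx.1 hy.1 ha hb hab, fun i hi =>
    convex_setOf_mul_norm_sub_sq_le (p k) (p i) hi (hx.2 i hi) (hy.2 i hi) ha hb hab⟩
end

section
/- (Integral decomposition over the relaxed region, Eq. (27)) Fix n sensors in ℝ² at locations p_1,…,p_n with positive cost parameters η_1,…,η_n, a set Q ⊆ ℝ², and a measurable set W ⊆ ℝ². For each k let V_k = {q ∈ Q : η_k‖q − p_k‖² ≤ η_t‖q − p_t‖² for all t} and V̄_k = {q ∈ Q : η_k‖q − p_k‖² ≤ η_i‖q − p_i‖² for all i with η_i ≤ η_k}, and assume the sets V_k, k = 1,…,n, are pairwise disjoint. Then for any function φ integrable on V̄_k ∩ W, ∫_{V_k ∩ W} φ(q) dq = ∫_{V̄_k ∩ W} φ(q) dq − Σ_{j : η_j > η_k} ∫_{V_j ∩ V̄_k ∩ W} φ(q) dq. -/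
open MeasureTheory

/-- integral decomposition over the relaxed region, Eq. (27): assuming the
weighted Voronoi regions are pairwise disjoint, for any function `φ` integrable on
`V̄ₖ ∩ W`,
`∫_{Vₖ ∩ W} φ = ∫_{V̄ₖ ∩ W} φ − Σ_{j : ηⱼ > ηₖ} ∫_{Vⱼ ∩ V̄ₖ ∩ W} φ`. -/
theorem integral_decomposition_relaxed_region
    {n : ℕ} (p : Fin n → EuclideanSpace ℝ (Fin 2))
    (η : Fin n → ℝ) (hη : ∀ i, 0 < η i)
    (Q : Set (EuclideanSpace ℝ (Fin 2))) (hQ : MeasurableSet Q)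
    (W : Set (EuclideanSpace ℝ (Fin 2))) (hW : MeasurableSet W)
    (V : Fin n → Set (EuclideanSpace ℝ (Fin 2)))
    (hV : ∀ k, V k = {q ∈ Q | ∀ t, η k * ‖q - p k‖ ^ 2 ≤ η t * ‖q - p t‖ ^ 2})
    (Vbar : Fin n → Set (EuclideanSpace ℝ (Fin 2)))
    (hVbar : ∀ k, Vbar k =
      {q ∈ Q | ∀ i, η i ≤ η k → η k * ‖q - p k‖ ^ 2 ≤ η i * ‖q - p i‖ ^ 2})
    (hdisj : Pairwise (Function.onFun Disjoint V))
    (k : Fin n)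
    (φ : EuclideanSpace ℝ (Fin 2) → ℝ)
    (hφ : IntegrableOn φ (Vbar k ∩ W)) :
    ∫ q in V k ∩ W, φ q
      = (∫ q in Vbar k ∩ W, φ q)
        - ∑ j ∈ Finset.univ.filter (fun j => η k < η j),
            ∫ q in V j ∩ Vbar k ∩ W, φ q := by
  have hmeas (i : Fin n) : Measurable fun q => η i * ‖q - p i‖ ^ 2 := by fun_prop
  have hVm (j : Fin n) : MeasurableSet (V j) := by
    rw [hV]
    simp only [Set.ofPred_and, Set.ofPred_forall]
    exact hQ.inter <| .iInter fun t => measurableSet_le (hmeas j) (hmeas t)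
  have hBm : MeasurableSet (Vbar k) := by
    rw [hVbar]
    simp only [Set.ofPred_and, Set.ofPred_forall]
    exact hQ.inter <| .iInter fun i => .iInter fun _ => measurableSet_le (hmeas k) (hmeas i)
  have hsub : V k ⊆ Vbar k := by
    intro q hq
    rw [hV] at hq
    rw [hVbar]
    exact ⟨hq.1, fun i _ => hq.2 i⟩
  set s := Finset.univ.filter fun j => η k < η j with hs
  have hcover : Vbar k ∩ W = (V k ∩ W) ∪ ⋃ j ∈ s, V j ∩ Vbar k ∩ W := by
    ext q
    simp only [Set.mem_union, Set.mem_iUnion, exists_prop, Set.mem_inter_iff]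
    constructor
    · rintro ⟨hq, hqW⟩
      have : Nonempty (Fin n) := ⟨k⟩
      obtain ⟨j, hj⟩ := Finite.exists_min fun t => η t * ‖q - p t‖ ^ 2
      have hq' := hq
      rw [hVbar] at hq'
      rcases le_or_gt (η j) (η k) with h | h
      · left
        rw [hV]
        exact ⟨⟨hq'.1, fun t => (hq'.2 j h).trans (hj t)⟩, hqW⟩
      · right
        refine ⟨j, by simpa [hs] using h, ⟨?_, hq⟩, hqW⟩
        rw [hV]
        exact ⟨hq'.1, hj⟩
    · rintro (⟨h, hqW⟩ | ⟨j, -, ⟨-, h⟩, hqW⟩)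
      · exact ⟨hsub h, hqW⟩
      · exact ⟨h, hqW⟩
  have hpm (j : Fin n) : MeasurableSet (V j ∩ Vbar k ∩ W) := ((hVm j).inter hBm).inter hW
  have hpsub (j : Fin n) : V j ∩ Vbar k ∩ W ⊆ Vbar k ∩ W := fun _ h => ⟨h.1.2, h.2⟩
  have hpV (j : Fin n) : V j ∩ Vbar k ∩ W ⊆ V j := fun _ h => h.1.1
  have hd : Disjoint (V k ∩ W) (⋃ j ∈ s, V j ∩ Vbar k ∩ W) := by
    simp only [Set.disjoint_iUnion_right]
    intro j hj
    have hjk : k ≠ j := by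
      rintro rfl
      simp [hs] at hj
    exact (hdisj hjk).mono Set.inter_subset_left (hpV j)
  have hsum : ∫ q in ⋃ j ∈ s, V j ∩ Vbar k ∩ W, φ q =
      ∑ j ∈ s, ∫ q in V j ∩ Vbar k ∩ W, φ q :=
    integral_biUnion_finset s (fun j _ => hpm j)
      (fun i _ j _ hij => (hdisj hij).mono (hpV i) (hpV j))
      (fun j _ => hφ.mono_set (hpsub j))
  rw [← hsum, eq_sub_iff_add_eq, hcover]
  exact (setIntegral_union hd (s.measurableSet_biUnion fun j _ => hpm j)
    (hφ.mono_set (Set.inter_subset_inter_left W hsub))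
    (hφ.mono_set (Set.iUnion₂_subset fun j _ => hpsub j))).symm
end
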